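/- Given linearly independent vectors v^{(1)},…,v^{(d)} ∈ ℝ^d and positive reals Y_1,…,Y_d, Z_1,…,Z_d, there exist vectors w^{(1)},…,w^{(d)} ∈ ℝ^d with |w^{(i)}_j| ≤ C(d)·min(Y_i |v^{(i)}|, Z_j) for all i, j, such that the set { z ∈ ℝ^d : z = Σ_i y_i v^{(i)} with |y_i| ≤ Y_i for all i, and |z_i| ≤ Z_i for all i } is contained in { Σ_i t_i w^{(i)} : |t_i| ≤ C(d) }, where C(d) depends only on d. -/

import Mathlib

open scoped BigOperators

section GreedyFrame

variable {E : Type*} [NormedAddCommGroup E] [InnerProductSpace ℝ E]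

/-- Every nonempty compact set `K` in an `n`-dimensional subspace lies in a box
spanned by `n` orthogonal vectors with decreasing norms, on which every linear functional is at
most `2 ^ n` times its supremum over `K`. -/
theorem exists_orthogonal_frame [FiniteDimensional ℝ E] (n : ℕ) :
    ∀ (S : Submodule ℝ E) (K : Set E), Module.finrank ℝ S = n → K ⊆ S → IsCompact K →
      K.Nonempty →
      ∃ w : Fin n → E, (∀ i, w i ∈ S) ∧ (∀ i j, i ≠ j → inner ℝ (w i) (w j) = 0) ∧
        (∀ i j, i ≤ j → ‖w j‖ ≤ ‖w i‖) ∧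
        (∀ R, (∀ z ∈ K, ‖z‖ ≤ R) → ∀ i, ‖w i‖ ≤ R) ∧
        (∀ (f : E →ₗ[ℝ] ℝ) (B : ℝ), (∀ z ∈ K, |f z| ≤ B) → ∀ i, |f (w i)| ≤ 2 ^ n * B) ∧
        ∀ z ∈ K, ∃ t : Fin n → ℝ, (∀ i, |t i| ≤ 1) ∧ z = ∑ i, t i • w i := by
  induction n with
  | zero =>
    intro S K hS hK _ _
    refine ⟨fun _ => 0, fun i => i.elim0, fun i => i.elim0, fun i => i.elim0,
      fun _ _ i => i.elim0, fun _ _ _ i => i.elim0, fun z hz => ⟨fun _ => 0, fun i => i.elim0, ?_⟩⟩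
    have h0 : S = ⊥ := Submodule.finrank_eq_zero.mp hS
    have : z ∈ S := hK hz
    rw [h0, Submodule.mem_bot] at this
    simp [this]
  | succ n ih =>
    intro S K hS hK hc hne
    obtain ⟨w₀, hw₀, hmax⟩ := hc.exists_isMaxOn hne continuous_norm.continuousOn
    replace hmax : ∀ z ∈ K, ‖z‖ ≤ ‖w₀‖ := fun z hz => hmax hz
    by_cases h0 : w₀ = 0
    · refine ⟨fun _ => 0, by simp, by simp, by simp, ?_, ?_, ?_⟩
      · intro R hR i
        simpa using (norm_nonneg _).trans (hR w₀ hw₀)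
      · intro f B hB i
        have := (abs_nonneg _).trans (hB w₀ hw₀)
        simp only [map_zero, abs_zero]
        positivity
      · intro z hz
        have := hmax z hz
        refine ⟨fun _ => 0, by simp, ?_⟩
        simpa [h0] using this
    have hn0 : 0 < ‖w₀‖ := norm_pos_iff.mpr h0
    let c : E → ℝ := fun z => inner ℝ w₀ z / ‖w₀‖ ^ 2
    let g : E → E := fun z => z - c z • w₀
    have hcK : ∀ z ∈ K, |c z| ≤ 1 := by
      intro z hz
      simp only [c]
      rw [abs_div, abs_of_pos (by positivity : 0 < ‖w₀‖ ^ 2), div_le_one (by positivity)]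
      calc |inner ℝ w₀ z| ≤ ‖w₀‖ * ‖z‖ := abs_real_inner_le_norm _ _
        _ ≤ ‖w₀‖ * ‖w₀‖ := by gcongr; exact hmax z hz
        _ = _ := by ring
    have hg0 : ∀ z, inner ℝ w₀ (g z) = 0 := by
      intro z
      simp only [g, c, inner_sub_right, inner_smul_right, real_inner_self_eq_norm_sq]
      field_simp
      ring
    have hgn : ∀ z, ‖g z‖ ≤ ‖z‖ := by
      intro z
      have hz : z = g z + c z • w₀ := by simp [g]
      have h1 : ‖z‖ * ‖z‖ = ‖g z‖ * ‖g z‖ + ‖c z • w₀‖ * ‖c z • w₀‖ := by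
        conv_lhs => rw [hz]
        apply norm_add_sq_eq_norm_sq_add_norm_sq_real
        rw [inner_smul_right, real_inner_comm, hg0, mul_zero]
      nlinarith [norm_nonneg z, norm_nonneg (g z), mul_self_nonneg ‖c z • w₀‖]
    have hgc : Continuous g := by
      simp only [g, c]
      fun_prop
    have hw₀S : w₀ ∈ S := hK hw₀
    let T : Submodule ℝ E := (ℝ ∙ w₀)ᗮ ⊓ S
    have hT : Module.finrank ℝ T = n := by
      have h1 := Submodule.finrank_add_inf_finrank_orthogonal
        (K₁ := ℝ ∙ w₀) (K₂ := S) (by simpa using hw₀S)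
      rw [finrank_span_singleton h0, hS] at h1
      change 1 + Module.finrank ℝ T = n + 1 at h1
      omega
    have hKT : g '' K ⊆ T := by
      rintro _ ⟨z, hz, rfl⟩
      refine ⟨?_, S.sub_mem (hK hz) (S.smul_mem _ hw₀S)⟩
      exact Submodule.mem_orthogonal_singleton_iff_inner_right.mpr (hg0 z)
    obtain ⟨w, hwT, horth, hanti, hR, hf, hz⟩ :=
      ih T (g '' K) hT hKT (hc.image hgc) (hne.image g)
    have hw0 : ∀ i, inner ℝ w₀ (w i) = 0 := fun i =>
      Submodule.mem_orthogonal_singleton_iff_inner_right.mp (hwT i).1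
    have hR' : ∀ i, ‖w i‖ ≤ ‖w₀‖ := by
      apply hR
      rintro _ ⟨z, hz, rfl⟩
      exact (hgn z).trans (hmax z hz)
    refine ⟨Fin.cons w₀ w, ?_, ?_, ?_, ?_, ?_, ?_⟩
    · intro i
      cases i using Fin.cases with
      | zero => simpa using hw₀S
      | succ i => simpa using (hwT i).2
    · intro i j hij
      cases i using Fin.cases with
      | zero =>
        cases j using Fin.cases with
        | zero => exact absurd rfl hij
        | succ j => simpa using hw0 j
      | succ i =>
        cases j using Fin.cases with
        | zero => simpa [real_inner_comm] using hw0 i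
        | succ j => simpa using horth i j (fun h => hij (by rw [h]))
    · intro i j hij
      cases j using Fin.cases with
      | zero =>
        obtain rfl : i = 0 := Fin.le_zero_iff.mp hij
        exact le_rfl
      | succ j =>
        cases i using Fin.cases with
        | zero => simpa using hR' j
        | succ i => simpa using hanti i j (Fin.succ_le_succ_iff.mp hij)
    · intro R h i
      cases i using Fin.cases with
      | zero => simpa using h w₀ hw₀
      | succ i => simpa using (hR' i).trans (h w₀ hw₀)
    · intro f B hB i
      have hB0 : 0 ≤ B := (abs_nonneg _).trans (hB w₀ hw₀)
      cases i using Fin.cases with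
      | zero =>
        have h1 : (1 : ℝ) ≤ 2 ^ (n + 1) := one_le_pow₀ (by norm_num)
        simpa using (hB w₀ hw₀).trans (le_mul_of_one_le_left hB0 h1)
      | succ i =>
        have h1 := hf f (2 * B) (by
          rintro _ ⟨z, hz, rfl⟩
          have h2 : |c z| * |f w₀| ≤ 1 * B :=
            mul_le_mul (hcK z hz) (hB w₀ hw₀) (abs_nonneg _) zero_le_one
          have h3 : |f (g z)| ≤ |f z| + |c z| * |f w₀| := by
            simp only [g, map_sub, map_smul, smul_eq_mul, ← abs_mul]
            exact abs_sub _ _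
          linarith [hB z hz]) i
        rw [Fin.cons_succ, pow_succ]
        linarith
    · intro z hzK
      obtain ⟨t, ht, hzt⟩ := hz (g z) ⟨z, hzK, rfl⟩
      refine ⟨Fin.cons (c z) t, ?_, ?_⟩
      · intro i
        cases i using Fin.cases with
        | zero => simpa using hcK z hzK
        | succ i => simpa using ht i
      · rw [Fin.sum_univ_succ]
        simp only [Fin.cons_zero, Fin.cons_succ, ← hzt, g]
        abel

/-- If `K` lies in the parallelepiped `{∑ yᵢ vᵢ : |yᵢ| ≤ Yᵢ}` with `Yᵢ ‖vᵢ‖` decreasing, then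
orthogonal vectors of decreasing norms that are dominated by `K` on linear functionals have norms
dominated by `Yᵢ ‖vᵢ‖`. -/
theorem norm_le_of_orthogonal_of_dominated {d : ℕ} {K : Set E} {v w : Fin d → E} {Y : Fin d → ℝ}
    {A : ℝ} (hA : 0 ≤ A) (hY : ∀ i, 0 ≤ Y i)
    (hanti : ∀ i j, i ≤ j → Y j * ‖v j‖ ≤ Y i * ‖v i‖)
    (hK : ∀ z ∈ K, ∃ y : Fin d → ℝ, (∀ i, |y i| ≤ Y i) ∧ z = ∑ i, y i • v i)
    (horth : ∀ i j, i ≠ j → inner ℝ (w i) (w j) = 0)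
    (hw : ∀ i j, i ≤ j → ‖w j‖ ≤ ‖w i‖)
    (hf : ∀ (f : E →ₗ[ℝ] ℝ) (B : ℝ), (∀ z ∈ K, |f z| ≤ B) → ∀ i, |f (w i)| ≤ A * B)
    (k : Fin d) : ‖w k‖ ≤ A * d ^ 2 * (Y k * ‖v k‖) := by
  have hYv : 0 ≤ Y k * ‖v k‖ := mul_nonneg (hY k) (norm_nonneg _)
  rcases (norm_nonneg (w k)).eq_or_lt with h0 | hpos
  · rw [← h0]; positivity
  let M : Matrix (Finset.Iio k) (Finset.Iic k) ℝ := fun j i => inner ℝ (w i) (v j)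
  have hker : LinearMap.ker M.mulVecLin ≠ ⊥ := by
    apply LinearMap.ker_ne_bot_of_finrank_lt
    rw [Module.finrank_fintype_fun_eq_card, Module.finrank_fintype_fun_eq_card,
      Fintype.card_coe, Fintype.card_coe, Fin.card_Iio, Fin.card_Iic]
    exact Nat.lt_succ_self _
  obtain ⟨c, hc, hc0⟩ := Submodule.exists_mem_ne_zero_of_ne_bot hker
  rw [LinearMap.mem_ker] at hc
  let u : E := ∑ i, c i • w i
  have huv : ∀ j, j < k → inner ℝ u (v j) = 0 := by
    intro j hj
    have := congrFun hc ⟨j, Finset.mem_Iio.mpr hj⟩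
    simp only [M, Pi.zero_apply] at this
    simp only [u, sum_inner, real_inner_smul_left]
    rw [← this]
    exact Finset.sum_congr rfl fun i _ => mul_comm _ _
  have huw : ∀ i : Finset.Iic k, inner ℝ u (w i) = c i * ‖w i‖ ^ 2 := by
    intro i
    simp only [u, sum_inner, real_inner_smul_left]
    rw [Finset.sum_eq_single i]
    · rw [real_inner_self_eq_norm_sq]
    · intro j _ hj
      rw [horth _ _ (fun h => hj (Subtype.ext h)), mul_zero]
    · simp
  obtain ⟨i₀, hi₀⟩ := Function.ne_iff.mp hc0
  have : Nonempty (Finset.Iic k) := ⟨i₀⟩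
  obtain ⟨i, hi⟩ := Finite.exists_max fun i : Finset.Iic k => |c i| * ‖w i‖
  set m := |c i| * ‖w i‖ with hm
  have hwpos : ∀ j : Finset.Iic k, ‖w k‖ ≤ ‖w j‖ := fun j => hw _ _ (Finset.mem_Iic.mp j.2)
  have hmpos : 0 < m := lt_of_lt_of_le
    (mul_pos (abs_pos.mpr hi₀) (hpos.trans_le (hwpos i₀))) (hi i₀)
  have hu : ‖u‖ ≤ d * m := by
    calc ‖u‖ ≤ ∑ j, ‖c j • w j‖ := norm_sum_le _ _
      _ ≤ ∑ _j : Finset.Iic k, m := by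
        refine Finset.sum_le_sum fun j _ => ?_
        rw [norm_smul]
        exact hi j
      _ = (k + 1 : ℕ) * m := by simp
      _ ≤ d * m := by
        gcongr
        exact k.2
  have hdom := hf (innerₛₗ ℝ u) (d * (‖u‖ * (Y k * ‖v k‖))) (by
    intro z hz
    obtain ⟨y, hy, rfl⟩ := hK z hz
    rw [innerₛₗ_apply_apply, inner_sum]
    calc |∑ j, inner ℝ u (y j • v j)| ≤ ∑ j, |inner ℝ u (y j • v j)| :=
          Finset.abs_sum_le_sum_abs _ _
      _ ≤ ∑ _j : Fin d, ‖u‖ * (Y k * ‖v k‖) := by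
        refine Finset.sum_le_sum fun j _ => ?_
        rw [inner_smul_right, abs_mul]
        rcases lt_or_ge j k with hj | hj
        · rw [huv j hj]
          simp only [abs_zero, mul_zero]
          positivity
        · calc |y j| * |inner ℝ u (v j)| ≤ Y j * (‖u‖ * ‖v j‖) :=
                mul_le_mul (hy j) (abs_real_inner_le_norm _ _) (abs_nonneg _) (hY j)
            _ = ‖u‖ * (Y j * ‖v j‖) := by ring
            _ ≤ _ := by gcongr ‖u‖ * ?_; exact hanti k j hj
      _ = _ := by simp) i
  rw [innerₛₗ_apply_apply, huw, abs_mul, abs_of_nonneg (sq_nonneg ‖w i‖)] at hdom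
  have hmain : m * ‖w i‖ ≤ m * (A * d ^ 2 * (Y k * ‖v k‖)) := by
    calc m * ‖w i‖ = |c i| * ‖w i‖ ^ 2 := by rw [hm]; ring
      _ ≤ A * (d * (‖u‖ * (Y k * ‖v k‖))) := hdom
      _ ≤ A * (d * (d * m * (Y k * ‖v k‖))) := by gcongr
      _ = _ := by ring
  exact (hwpos i).trans (le_of_mul_le_mul_left hmain hmpos)

end GreedyFrame

/-- a polytope cut out by coefficient bounds `|yᵢ| ≤ Yᵢ` (with respect to a basis
`v⁽ⁱ⁾`) and coordinate bounds `|zⱼ| ≤ Zⱼ` is contained in a parallelepiped generated by vectors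
`w⁽ⁱ⁾` with `|w⁽ⁱ⁾ⱼ| ≤ C(d) min(Yᵢ |v⁽ⁱ⁾|, Zⱼ)`. -/
theorem stmt5 (d : ℕ) :
    ∃ C : ℝ, 0 < C ∧
      ∀ (v : Fin d → EuclideanSpace ℝ (Fin d)) (Y Z : Fin d → ℝ),
        LinearIndependent ℝ v → (∀ i, 0 < Y i) → (∀ i, 0 < Z i) →
          ∃ w : Fin d → EuclideanSpace ℝ (Fin d),
            (∀ i j, |w i j| ≤ C * min (Y i * ‖v i‖) (Z j)) ∧
              ∀ z : EuclideanSpace ℝ (Fin d),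
                (∃ y : Fin d → ℝ, (∀ i, |y i| ≤ Y i) ∧ z = ∑ i, y i • v i) →
                (∀ i, |z i| ≤ Z i) →
                  ∃ t : Fin d → ℝ, (∀ i, |t i| ≤ C) ∧ z = ∑ i, t i • w i := by
  have h2 : (1 : ℝ) ≤ 2 ^ d := one_le_pow₀ (by norm_num)
  have hd : (1 : ℝ) ≤ ((d : ℝ) + 1) ^ 2 := one_le_pow₀ (by simp)
  refine ⟨2 ^ d * ((d : ℝ) + 1) ^ 2, by positivity, ?_⟩
  intro v Y Z _ hY hZ
  let K : Set (EuclideanSpace ℝ (Fin d)) :=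
    (fun y : Fin d → ℝ => ∑ i, y i • v i) '' Set.Icc (-Y) Y ∩ {z | ∀ i, |z i| ≤ Z i}
  have hKc : IsCompact K := by
    refine (isCompact_Icc.image (by fun_prop)).inter_right ?_
    simp only [Set.ofPred_forall]
    exact isClosed_iInter fun i => isClosed_le (by fun_prop) continuous_const
  have hKne : K.Nonempty :=
    ⟨0, ⟨0, ⟨fun i => by simpa using (hY i).le, fun i => (hY i).le⟩, by simp⟩,
      fun i => by simpa using (hZ i).le⟩
  obtain ⟨w, -, horth, hanti, -, hf, hz⟩ :=
    exists_orthogonal_frame d (⊤ : Submodule ℝ (EuclideanSpace ℝ (Fin d))) K (by simp)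
      (fun _ _ => trivial) hKc hKne
  let σ : Equiv.Perm (Fin d) := Tuple.sort fun i => -(Y i * ‖v i‖)
  have hσ : ∀ i j, i ≤ j → Y (σ j) * ‖v (σ j)‖ ≤ Y (σ i) * ‖v (σ i)‖ := fun i j hij =>
    neg_le_neg_iff.mp (Tuple.monotone_sort (fun i => -(Y i * ‖v i‖)) hij)
  have hnorm : ∀ k, ‖w k‖ ≤ 2 ^ d * d ^ 2 * (Y (σ k) * ‖v (σ k)‖) :=
    norm_le_of_orthogonal_of_dominated (K := K) (v := v ∘ σ) (Y := Y ∘ σ) (by positivity)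
      (fun i => (hY _).le) hσ
      (by
        rintro z ⟨⟨y, hy, rfl⟩, -⟩
        refine ⟨y ∘ σ, fun i => abs_le.mpr ⟨hy.1 _, hy.2 _⟩, ?_⟩
        exact (Equiv.sum_comp σ fun i => y i • v i).symm)
      horth hanti hf
  refine ⟨w ∘ σ.symm, ?_, ?_⟩
  · intro i j
    have hYv : 0 ≤ Y i * ‖v i‖ := mul_nonneg (hY i).le (norm_nonneg _)
    rw [mul_min_of_nonneg _ _ (by positivity), le_min_iff]
    constructor
    · have h1 := hnorm (σ.symm i)
      rw [Equiv.apply_symm_apply] at h1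
      refine (PiLp.norm_apply_le (w (σ.symm i)) j).trans (h1.trans ?_)
      gcongr
      simp
    · have h1 := hf (EuclideanSpace.proj j : EuclideanSpace ℝ (Fin d) →L[ℝ] ℝ).toLinearMap (Z j)
        (fun z hz => hz.2 j) (σ.symm i)
      refine h1.trans ?_
      gcongr
      · exact (hZ j).le
      · exact le_mul_of_one_le_right (by positivity) hd
  · rintro z ⟨y, hy, rfl⟩ hzZ
    obtain ⟨t, ht, hzt⟩ := hz _
      ⟨⟨y, ⟨fun i => (abs_le.mp (hy i)).1, fun i => (abs_le.mp (hy i)).2⟩, rfl⟩, hzZ⟩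
    refine ⟨t ∘ σ.symm, fun i => (ht _).trans (one_le_mul_of_one_le_of_one_le h2 hd), ?_⟩
    exact hzt.trans (Equiv.sum_comp σ.symm fun i => t i • w i).symm
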